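/- Let m be an odd prime, let α, β ≥ 1, and let (G, a, b) be an atomic chiral rotation pair of type (2·m^α, m^{α+β}). Then α = 1, and there exists an integer k with 1 ≤ k ≤ m−1 such that in G the relations b⁻¹ * a = a^3 * b^(1 + k·m^β) and b * a⁻¹ = a^(−3) * b^(−1 + k·m^β) hold. -/

import Mathlib

/-- A rotation pair of type `(p, q)`: the group is generated by `a` and `b`,
`a` has order `p`, `b` has order `q`, `p, q ≥ 2`, `(a*b)^2 = 1`, and the cyclic
subgroups generated by `a` and `b` intersect trivially. -/
def IsRotPair {G : Type*} [Group G] (a b : G) (p q : ℕ) : Prop :=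
  Subgroup.closure ({a, b} : Set G) = ⊤ ∧ orderOf a = p ∧ orderOf b = q ∧
    2 ≤ p ∧ 2 ≤ q ∧ (a * b) ^ 2 = 1 ∧
    Subgroup.zpowers a ⊓ Subgroup.zpowers b = ⊥

/-- Tightness: every element is `a ^ i * b ^ j` for some integers `i, j`. -/
def IsTight {G : Type*} [Group G] (a b : G) : Prop :=
  ∀ g : G, ∃ i j : ℤ, g = a ^ i * b ^ j

/-- Orientably regular: some group automorphism inverts both generators. -/
def IsOrientablyRegular {G : Type*} [Group G] (a b : G) : Prop :=
  ∃ φ : G ≃* G, φ a = a⁻¹ ∧ φ b = b⁻¹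

/-- Chiral: no group automorphism inverts both generators. -/
def IsChiral {G : Type*} [Group G] (a b : G) : Prop :=
  ¬ IsOrientablyRegular a b

/-- `(G, a, b)` covers `(H, a', b')` if a homomorphism sends `a ↦ a'`, `b ↦ b'`. -/
def Covers {G H : Type*} [Group G] [Group H] (a b : G) (a' b' : H) : Prop :=
  ∃ f : G →* H, f a = a' ∧ f b = b'

/-- An atomic chiral rotation pair of type `(p, q)`: a tight chiral rotation pair
covering no tight chiral rotation pair of type `(p', q)` with `p' < p` nor one of
type `(p, q')` with `q' < q`. -/
def IsAtomicPair {G : Type*} [Group G] (a b : G) (p q : ℕ) : Prop :=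
  IsRotPair a b p q ∧ IsTight a b ∧ IsChiral a b ∧
  (∀ (H : Type) (instH : Group H) (_ : Finite H) (a' b' : H) (p' : ℕ), p' < p →
      @IsRotPair H instH a' b' p' q → @IsTight H instH a' b' → @IsChiral H instH a' b' →
      ¬ @Covers G H _ instH a b a' b') ∧
  (∀ (H : Type) (instH : Group H) (_ : Finite H) (a' b' : H) (q' : ℕ), q' < q →
      @IsRotPair H instH a' b' p q' → @IsTight H instH a' b' → @IsChiral H instH a' b' →
      ¬ @Covers G H _ instH a b a' b')


/-- sign homomorphism -/
lemma exists_sgn {G : Type*} [Group G] [Finite G] {a b : G} {p q : ℕ} (hp : Even p) (hq : Odd q)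
    (h : IsRotPair a b p q) (ht : IsTight a b) :
    ∃ s : G →* ℤˣ, s a = -1 ∧ s b = 1 := by
  classical
  obtain ⟨-, hoa, hob, hp2, -, -, hint⟩ := h
  let X := G ⧸ Subgroup.zpowers b
  have : Fintype X := Fintype.ofFinite X
  let ρ := MulAction.toPermHom G X
  have hρ : ∀ g x : G, ρ g (QuotientGroup.mk x : X) = (QuotientGroup.mk (g * x) : X) := fun g x => rfl
  have hzero : ∀ i : ℤ, a ^ i ∈ Subgroup.zpowers b → a ^ i = 1 := by
    intro i hi
    have : a ^ i ∈ Subgroup.zpowers a ⊓ Subgroup.zpowers b := ⟨⟨i, rfl⟩, hi⟩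
    rw [hint] at this
    exact this
  have hrep : ∀ x : X, ∃ i : ℤ, x = (QuotientGroup.mk (a ^ i) : X) := by
    intro x
    obtain ⟨g, rfl⟩ := QuotientGroup.mk_surjective x
    obtain ⟨i, j, rfl⟩ := ht g
    refine ⟨i, ?_⟩
    rw [eq_comm, QuotientGroup.eq]
    exact ⟨j, by simp⟩
  have hmove : ∀ x : X, ρ a x ≠ x := by
    intro x hx
    obtain ⟨i, rfl⟩ := hrep x
    rw [hρ, eq_comm, QuotientGroup.eq] at hx
    have e : (a ^ i)⁻¹ * (a * a ^ i) = a ^ (1 : ℤ) := by group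
    rw [e] at hx
    have := hzero 1 hx
    rw [zpow_one] at this
    rw [this, orderOf_one] at hoa
    omega
  have hpow : ∀ i : ℤ, ((ρ a) ^ i) (QuotientGroup.mk 1 : X) = (QuotientGroup.mk (a ^ i) : X) := by
    intro i
    rw [← map_zpow, hρ, mul_one]
  have hcyc : (ρ a).IsCycle := by
    refine ⟨(QuotientGroup.mk 1 : X), hmove _, ?_⟩
    intro y _
    obtain ⟨i, rfl⟩ := hrep y
    exact ⟨i, hpow i⟩
  have hsupp : (ρ a).support = Finset.univ := by
    ext x
    simp [hmove x]
  have hord : orderOf (ρ a) = p := by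
    rw [← hoa]
    apply orderOf_eq_orderOf_iff.2
    intro n
    constructor
    · intro hn
      have := hpow n
      rw [zpow_natCast, hn, Equiv.Perm.one_apply, QuotientGroup.eq] at this
      have := hzero n (by simpa using this)
      simpa using this
    · intro hn
      rw [← map_pow, hn, map_one]
  have hcard : (ρ a).support.card = p := by rw [← hord, hcyc.orderOf]
  refine ⟨Equiv.Perm.sign.comp ρ, ?_, ?_⟩
  · rw [MonoidHom.comp_apply, hcyc.sign, hcard, hp.neg_one_pow]
  · set s := Equiv.Perm.sign.comp ρ
    have h1 : s b ^ q = 1 := by rw [← map_pow, ← hob, pow_orderOf_eq_one, map_one]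
    rcases Int.units_eq_one_or (s b) with h | h
    · exact h
    · rw [h, hq.neg_one_pow] at h1
      exact absurd h1 (by decide)

lemma ker_form {G : Type*} [Group G] {a b : G} (ht : IsTight a b) {s : G →* ℤˣ}
    (hsa : s a = -1) (hsb : s b = 1) {g : G} (hg : s g = 1) :
    ∃ i j : ℤ, g = (a ^ 2) ^ i * b ^ j := by
  obtain ⟨i, j, rfl⟩ := ht g
  rcases Int.even_or_odd' i with ⟨k, rfl | rfl⟩
  · exact ⟨k, j, by rw [zpow_mul]; norm_cast⟩
  · exfalso
    rw [map_mul, map_zpow, map_zpow, hsa, hsb, zpow_add, zpow_mul] at hg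
    simp at hg

/-- commuting implies regular -/
lemma regular_of_comm {G : Type*} [Group G] [Finite G] {a b : G} {p q : ℕ} (hp : Even p) (hq : Odd q)
    (h : IsRotPair a b p q) (ht : IsTight a b) (hc : Commute (a ^ 2) b) :
    IsOrientablyRegular a b := by
  classical
  obtain ⟨s, hsa, hsb⟩ := exists_sgn hp hq h ht
  obtain ⟨-, -, -, -, -, hab, -⟩ := h
  have hcomm : ∀ g k : G, s g = 1 → s k = 1 → g * k = k * g := by
    intro g k hg hk
    obtain ⟨i, j, rfl⟩ := ker_form ht hsa hsb hg
    obtain ⟨i', j', rfl⟩ := ker_form ht hsa hsb hk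
    have c1 : Commute ((a ^ 2) ^ i) ((a ^ 2) ^ i' * b ^ j') :=
      ((Commute.refl _).zpow_zpow i i').mul_right (hc.zpow_zpow _ _)
    have c2 : Commute (b ^ j) ((a ^ 2) ^ i' * b ^ j') :=
      (hc.symm.zpow_zpow _ _).mul_right ((Commute.refl _).zpow_zpow _ _)
    exact (c1.mul_left c2)
  obtain ⟨t, ht_def⟩ : ∃ t, t = a * b := ⟨_, rfl⟩
  have htt : t * t = 1 := by rw [← pow_two, ht_def]; exact hab
  have hti : t⁻¹ = t := inv_eq_of_mul_eq_one_left htt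
  have hst : s t = -1 := by rw [ht_def, map_mul, hsa, hsb, mul_one]
  have hne : (-1 : ℤˣ) ≠ 1 := by decide
  have hcases : ∀ g, s g ≠ 1 → ∃ k, s k = 1 ∧ g = t * k := by
    intro g hg
    refine ⟨t * g, ?_, ?_⟩
    · rcases Int.units_eq_one_or (s g) with h | h
      · exact absurd h hg
      · rw [map_mul, hst, h]; decide
    · rw [← mul_assoc, htt, one_mul]
  let f : G → G := fun g => if s g = 1 then g⁻¹ else t * g⁻¹ * t
  have f1 : ∀ g, s g = 1 → f g = g⁻¹ := fun g hg => if_pos hg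
  have f2 : ∀ g, s g = 1 → f (t * g) = t * g⁻¹ := by
    intro g hg
    have : s (t * g) ≠ 1 := by rw [map_mul, hst, hg, mul_one]; exact hne
    change (if s (t * g) = 1 then _ else _) = _
    rw [if_neg this, mul_inv_rev, hti, mul_assoc, mul_assoc, htt, mul_one]
  have st2 : ∀ g, s g = 1 → s (t * g * t) = 1 := by
    intro g hg
    rw [map_mul, map_mul, hst, hg]; decide
  have sinv : ∀ g, s g = 1 → s g⁻¹ = 1 := by
    intro g hg
    rw [map_inv, hg, inv_one]
  have smul : ∀ g k, s g = 1 → s k = 1 → s (g * k) = 1 := by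
    intro g k hg hk
    rw [map_mul, hg, hk, one_mul]
  have fmul : ∀ g k, f (g * k) = f g * f k := by
    intro g k
    by_cases hg : s g = 1
    · by_cases hk : s k = 1
      · rw [f1 _ (smul _ _ hg hk), f1 _ hg, f1 _ hk, mul_inv_rev]
        exact hcomm _ _ (sinv _ hk) (sinv _ hg)
      · obtain ⟨k', hk', rfl⟩ := hcases k hk
        clear hk; rename' k' => k, hk' => hk
        have e : g * (t * k) = t * ((t * g * t) * k) := by
          have : t * ((t * g * t) * k) = (t * t) * g * (t * k) := by group
          rw [this, htt, one_mul]
        rw [e, f2 _ (smul _ _ (st2 _ hg) hk), f1 _ hg, f2 _ hk,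
          hcomm _ _ (st2 _ hg) hk]
        simp only [mul_inv_rev, hti]
        have : t * (t * (g⁻¹ * t) * k⁻¹) = (t * t) * g⁻¹ * (t * k⁻¹) := by group
        rw [this, htt, one_mul]
    · obtain ⟨g', hg', rfl⟩ := hcases g hg
      clear hg; rename' g' => g, hg' => hg
      by_cases hk : s k = 1
      · rw [mul_assoc, f2 _ (smul _ _ hg hk), f2 _ hg, f1 _ hk, hcomm _ _ hg hk, mul_inv_rev,
          mul_assoc]
      · obtain ⟨k', hk', rfl⟩ := hcases k hk
        clear hk; rename' k' => k, hk' => hk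
        have e : t * g * (t * k) = (t * g * t) * k := by group
        rw [e, f1 _ (smul _ _ (st2 _ hg) hk), f2 _ hg, f2 _ hk, hcomm _ _ (st2 _ hg) hk]
        simp only [mul_inv_rev, hti]
        group
  have ff : ∀ g, f (f g) = g := by
    intro g
    by_cases hg : s g = 1
    · rw [f1 _ hg, f1 _ (sinv _ hg), inv_inv]
    · obtain ⟨g', hg', rfl⟩ := hcases g hg
      clear hg; rename' g' => g, hg' => hg
      rw [f2 _ hg, f2 _ (sinv _ hg), inv_inv]
  let F : G ≃* G := { toFun := f, invFun := f, left_inv := ff, right_inv := ff, map_mul' := fmul }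
  refine ⟨F.trans (MulAut.conj b), ?_, ?_⟩
  · change b * f a * b⁻¹ = a⁻¹
    have : f a = t * b := by
      have e : a = t * b⁻¹ := by rw [ht_def]; group
      conv_lhs => rw [e]
      rw [f2 _ (sinv _ hsb), inv_inv]
    rw [this, ht_def]
    have h2 : a * (b * (a * b)) = 1 := by rw [← hab, pow_two]; group
    rw [eq_comm, inv_eq_iff_mul_eq_one, ← h2]
    group
  · change b * f b * b⁻¹ = b⁻¹
    rw [f1 _ hsb]; group

lemma zero_b {G : Type*} [Group G] {a b : G} {p q : ℕ} (h : IsRotPair a b p q) {g : G}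
    (h1 : g ∈ Subgroup.zpowers a) (h2 : g ∈ Subgroup.zpowers b) : g = 1 := by
  have : g ∈ Subgroup.zpowers a ⊓ Subgroup.zpowers b := ⟨h1, h2⟩
  rw [h.2.2.2.2.2.2] at this
  exact this

lemma card_eq {G : Type*} [Group G] [Finite G] {a b : G} {p q : ℕ} (h : IsRotPair a b p q)
    (ht : IsTight a b) : Nat.card G = p * q := by
  let F : Subgroup.zpowers a × Subgroup.zpowers b → G := fun x => x.1 * x.2
  have hF : Function.Bijective F := by
    constructor
    · rintro ⟨⟨x, hx⟩, ⟨y, hy⟩⟩ ⟨⟨x', hx'⟩, ⟨y', hy'⟩⟩ e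
      change x * y = x' * y' at e
      have e2 : x'⁻¹ * x = y' * y⁻¹ := by
        rw [inv_mul_eq_iff_eq_mul, ← mul_assoc, ← e]; group
      have h1 : x'⁻¹ * x = 1 := zero_b h (mul_mem (inv_mem hx') hx)
        (by rw [e2]; exact mul_mem hy' (inv_mem hy))
      have h2 : y' * y⁻¹ = 1 := by rw [← e2, h1]
      have hx : x' = x := by rwa [inv_mul_eq_one] at h1
      have hy : y' = y := by rwa [mul_inv_eq_one] at h2
      subst hx hy; rfl
    · intro g
      obtain ⟨i, j, rfl⟩ := ht g
      exact ⟨⟨⟨a ^ i, i, rfl⟩, ⟨b ^ j, j, rfl⟩⟩, rfl⟩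
  rw [← Nat.card_congr (Equiv.ofBijective F hF), Nat.card_prod, Nat.card_zpowers, Nat.card_zpowers,
    h.2.1, h.2.2.1]

/-- If `g` commutes after a power prime to the order, it commutes. -/
lemma commute_of_pow {G : Type*} [Group G] {y : G} {m e : ℕ} {u : ℤ} (hm : m.Prime)
    (hy : y ^ (m ^ e) = 1) (hu : ¬ (m : ℤ) ∣ u) (K : Subgroup G) (hc : y ^ u ∈ K) :
    y ∈ K := by
  have hcop : IsCoprime u ((m : ℤ) ^ e) := by
    apply IsCoprime.pow_right
    rw [isCoprime_comm]
    exact (Prime.coprime_iff_not_dvd (Nat.prime_iff_prime_int.1 hm)).2 hu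
  obtain ⟨r, w, hrw⟩ := hcop
  have : y = (y ^ u) ^ r := by
    rw [← zpow_mul]
    conv_lhs => rw [← zpow_one y, ← hrw, zpow_add, zpow_mul' y w]
    have : y ^ ((m : ℤ) ^ e) = 1 := by exact_mod_cast hy
    rw [this, one_zpow, mul_one, mul_comm]
  rw [this]
  exact K.zpow_mem hc r

lemma comm_of_regular {G : Type*} [Group G] [Finite G] {a b : G} {m A D : ℕ} (hm : m.Prime)
    (hmo : Odd m) (hA : 1 ≤ A)
    (h : IsRotPair a b (2 * m ^ A) (m ^ D)) (ht : IsTight a b) (hr : IsOrientablyRegular a b) :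
    Commute (a ^ 2) b := by
  obtain ⟨s, hsa, hsb⟩ := exists_sgn (even_two_mul _) hmo.pow h ht
  have hcard := card_eq h ht
  obtain ⟨-, hoa, hob, -, -, hab, -⟩ := id h
  obtain ⟨φ, hφa, hφb⟩ := hr
  obtain ⟨y, hy⟩ : ∃ y, y = a ^ 2 := ⟨_, rfl⟩
  have hym : y ^ (m ^ A) = 1 := by
    rw [hy, ← pow_mul, ← hoa, pow_orderOf_eq_one]
  obtain ⟨u, v, huv⟩ : ∃ u v : ℤ, b * y = y ^ u * b ^ v := by
    rw [hy]
    apply ker_form ht hsa hsb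
    rw [map_mul, map_pow, hsa, hsb]; decide
  rw [← hy]
  have hya : a * y = y * a := by rw [hy]; group
  have hsy : s y = 1 := by rw [hy, map_pow, hsa]; decide
  -- conjugates
  have hc1 : (a * b * a⁻¹) * y = y ^ u * (a * b * a⁻¹) ^ v := by
    have := congrArg (fun g => a * g * a⁻¹) huv
    rw [conj_zpow]
    have e1 : a * (b * y) * a⁻¹ = a * b * a⁻¹ * y := by rw [hy]; group
    have e2 : a * (y ^ u * b ^ v) * a⁻¹ = y ^ u * (a * b ^ v * a⁻¹) := by
      have : Commute a (y ^ u) := Commute.zpow_right hya u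
      rw [← mul_assoc a, this.eq]; group
    rw [← e1, ← e2, this]
  have hc2 : (a⁻¹ * b * a) * y = y ^ u * (a⁻¹ * b * a) ^ v := by
    have := congrArg (fun g => a⁻¹ * g * a) huv
    have e0 : (a⁻¹ * b * a) ^ v = a⁻¹ * b ^ v * a := by
      have := conj_zpow (i := v) (a := a⁻¹) (b := b)
      rwa [inv_inv] at this
    rw [e0]
    have e1 : a⁻¹ * (b * y) * a = a⁻¹ * b * a * y := by rw [hy]; group
    have e2 : a⁻¹ * (y ^ u * b ^ v) * a = y ^ u * (a⁻¹ * b ^ v * a) := by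
      have : Commute a⁻¹ (y ^ u) := Commute.zpow_right (Commute.inv_left hya) u
      rw [← mul_assoc a⁻¹, this.eq]; group
    rw [← e1, ← e2, this]
  obtain ⟨c, hc⟩ : ∃ c, c = a * b * a⁻¹ := ⟨_, rfl⟩
  have hφy : φ y = y⁻¹ := by rw [hy, map_pow, hφa, inv_pow]
  have hc3 : y * c = c ^ v * y ^ u := by
    have := congrArg φ hc2
    simp only [map_mul, map_zpow, map_inv, hφa, hφb, hφy, inv_inv] at this
    have e : a * b⁻¹ * a⁻¹ = c⁻¹ := by rw [hc]; group
    rw [e] at this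
    have := congrArg (fun g => g⁻¹) this
    simpa using this
  rw [← hc] at hc1
  have hc4 : Commute (y ^ (u + 1)) c := by
    have e1 : c ^ v = y * c * y ^ (-u) := by rw [hc3]; group
    rw [e1] at hc1
    have : y ^ (u + 1) * c = c * y ^ (u + 1) := by
      have h1 : y ^ (u + 1) * c = (y ^ u * (y * c * y ^ (-u))) * y ^ u := by group
      rw [h1, ← hc1]; group
    exact this
  have hcb : c⁻¹ = y * b := by
    have : a * b * (a * b) = 1 := by rw [← pow_two]; exact hab
    have h2 : b⁻¹ = a * b * a := by
      apply inv_eq_of_mul_eq_one_left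
      rw [← this]; group
    rw [hc, hy]
    simp only [mul_inv_rev, inv_inv, h2, pow_two]
    group
  have hc5 : Commute (y ^ (u + 1)) b := by
    have e : b = y⁻¹ * c⁻¹ := by rw [hcb]; group
    rw [e]
    exact ((Commute.refl y).zpow_left _).inv_right.mul_right hc4.inv_right
  by_cases hd : (m : ℤ) ∣ u + 1
  · have hd2 : ¬ (m : ℤ) ∣ u - 1 := by
      intro h3
      have : (m : ℤ) ∣ 2 := by
        have := dvd_sub hd h3
        ring_nf at this; exact this
      have h4 : m ∣ 2 := by exact_mod_cast this
      have := (Nat.prime_dvd_prime_iff_eq hm Nat.prime_two).1 h4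
      subst this
      exact absurd hmo (by decide)
    -- index m subgroup
    exfalso
    have : Fact m.Prime := ⟨hm⟩
    let P := s.ker
    have hP2 : P.index = 2 := by
      have hs : s.range = ⊤ := by
        rw [eq_top_iff]
        rintro x -
        rcases Int.units_eq_one_or x with rfl | rfl
        · exact one_mem _
        · exact ⟨a, hsa⟩
      rw [Subgroup.index_ker, hs, Subgroup.card_top, Nat.card_eq_fintype_card,
        Fintype.card_units_int]
    have hPcard : Nat.card P = m ^ (A + D) := by
      have := P.card_mul_index
      rw [hP2, hcard, pow_add] at *
      nlinarith
    let b' : P := ⟨b, hsb⟩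
    let y' : P := ⟨y, hsy⟩
    have hb' : Nat.card (Subgroup.zpowers b') = m ^ D := by
      rw [Nat.card_zpowers, ← hob]
      exact (Subgroup.orderOf_mk b hsb)
    obtain ⟨K, hK, hbK⟩ := Sylow.exists_subgroup_card_pow_prime_le m (n := D) (m := A + D - 1)
      (by rw [hPcard]; exact pow_dvd_pow _ (by omega)) (Subgroup.zpowers b') hb' (by omega)
    have hKi : K.index = m := by
      have := K.card_mul_index
      rw [hK, hPcard, show A + D = (A + D - 1) + 1 by omega, pow_succ] at this
      exact Nat.eq_of_mul_eq_mul_left (pow_pos hm.pos _) this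
    have hKn : K.Normal := by
      apply Subgroup.normal_of_index_eq_minFac_card
      rw [hKi, hPcard, hm.pow_minFac (by omega)]
    have hrel : b' * y' = y' ^ u * b' ^ v := Subtype.ext (by simpa using huv)
    have hbK' : b' ∈ K := hbK (Subgroup.mem_zpowers _)
    have hyu : y' ^ (u - 1) ∈ K := by
      have e : y' ^ (u - 1) = b' * (y' * b' ^ (-v) * y'⁻¹) := by
        have : y' ^ u = b' * y' * b' ^ (-v) := by rw [hrel]; group
        rw [zpow_sub_one, this]; group
      rw [e]
      exact mul_mem hbK' (hKn.conj_mem _ (zpow_mem hbK' _) _)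
    have hyK : y' ∈ K := commute_of_pow hm (e := A) (Subtype.ext (by simpa using hym)) hd2 K hyu
    have : K = ⊤ := by
      rw [eq_top_iff]
      rintro ⟨g, hg⟩ -
      obtain ⟨i, j, e⟩ := ker_form ht hsa hsb hg
      have : (⟨g, hg⟩ : P) = y' ^ i * b' ^ j := Subtype.ext (by
        change g = _
        rw [e, ← hy]; simp [y', b'])
      rw [this]
      exact mul_mem (zpow_mem hyK _) (zpow_mem hbK' _)
    rw [this, Subgroup.index_top] at hKi
    exact hm.one_lt.ne hKi
  · have : y ∈ Subgroup.centralizer {b} := commute_of_pow hm hym hd _ (by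
      rw [Subgroup.mem_centralizer_singleton_iff]; exact hc5.eq)
    rw [Subgroup.mem_centralizer_singleton_iff] at this
    exact this

lemma tight_map {G H : Type*} [Group G] [Group H] {a b : G} (f : G →* H)
    (hf : Function.Surjective f) (ht : IsTight a b) : IsTight (f a) (f b) := by
  intro g
  obtain ⟨g, rfl⟩ := hf g
  obtain ⟨i, j, rfl⟩ := ht g
  exact ⟨i, j, by simp⟩

lemma closure_map {G H : Type*} [Group G] [Group H] {a b : G} (f : G →* H)
    (hf : Function.Surjective f) (hc : Subgroup.closure ({a, b} : Set G) = ⊤) :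
    Subgroup.closure ({f a, f b} : Set H) = ⊤ := by
  have := congrArg (Subgroup.map f) hc
  rw [MonoidHom.map_closure, Set.image_pair, Subgroup.map_top_of_surjective f hf] at this
  exact this

lemma order_map_same {G H : Type*} [Group G] [Group H] {a : G} (f : G →* H)
    (h : ∀ n : ℕ, f (a ^ n) = 1 → a ^ n = 1) : orderOf (f a) = orderOf a := by
  apply orderOf_eq_orderOf_iff.2
  intro n
  rw [← map_pow]
  exact ⟨h n, fun e => by rw [e, map_one]⟩

lemma order_map_quot {G H : Type*} [Group G] [Group H] {b : G} (f : G →* H) {n : ℕ}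
    (hn : n ∣ orderOf b) (hk : f.ker = Subgroup.zpowers (b ^ n)) : orderOf (f b) = n := by
  apply Nat.dvd_antisymm
  · rw [orderOf_dvd_iff_pow_eq_one, ← map_pow, ← MonoidHom.mem_ker, hk]
    exact Subgroup.mem_zpowers _
  · have : b ^ orderOf (f b) ∈ f.ker := by rw [MonoidHom.mem_ker, map_pow, pow_orderOf_eq_one]
    rw [hk] at this
    obtain ⟨k, hk⟩ := this
    simp only [← zpow_natCast, ← zpow_mul] at hk
    have h1 := (zpow_eq_zpow_iff_modEq).1 hk
    have h2 : (n : ℤ) ∣ (orderOf (f b) : ℤ) - n * k :=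
      (Int.natCast_dvd_natCast.2 hn).trans h1.dvd
    have h3 : (n : ℤ) ∣ (orderOf (f b) : ℤ) := by
      have := dvd_add h2 (dvd_mul_right (n : ℤ) k)
      simpa using this
    exact_mod_cast h3

lemma rot_map {G H : Type*} [Group G] [Group H] {a b : G} {p q p' q' : ℕ} (f : G →* H)
    (hf : Function.Surjective f) (h : IsRotPair a b p q) (hp : orderOf (f a) = p')
    (hq : orderOf (f b) = q') (hp' : 2 ≤ p') (hq' : 2 ≤ q')
    (hk : f.ker ≤ Subgroup.zpowers a ∨ f.ker ≤ Subgroup.zpowers b) :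
    IsRotPair (f a) (f b) p' q' := by
  refine ⟨closure_map f hf h.1, hp, hq, hp', hq', ?_, ?_⟩
  · rw [← map_mul, ← map_pow, h.2.2.2.2.2.1, map_one]
  · rw [eq_bot_iff]
    rintro g ⟨⟨i, rfl⟩, ⟨j, hj⟩⟩
    simp only [← map_zpow] at hj ⊢
    have hm : b ^ j * (a ^ i)⁻¹ ∈ f.ker := by
      rw [MonoidHom.mem_ker, map_mul, hj, map_inv, mul_inv_cancel]
    rw [Subgroup.mem_bot]
    rcases hk with hk | hk
    · have h1 : b ^ j ∈ Subgroup.zpowers a := by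
        have := mul_mem (hk hm) (Subgroup.zpow_mem_zpowers a i)
        simpa using this
      rw [← hj, zero_b h h1 (Subgroup.zpow_mem_zpowers b j), map_one]
    · have h1 : a ^ i ∈ Subgroup.zpowers b := by
        have := mul_mem (inv_mem (hk hm)) (Subgroup.zpow_mem_zpowers b j)
        simpa using this
      rw [zero_b h (Subgroup.zpow_mem_zpowers a i) h1, map_one]

lemma exists_quot {G : Type*} [Group G] [Finite G] (N : Subgroup G) [N.Normal] :
    ∃ (H : Type) (_ : Group H) (_ : Finite H) (f : G →* H), Function.Surjective f ∧ f.ker = N := by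
  have : Countable (G ⧸ N) := Finite.to_countable
  let e : Shrink.{0} (G ⧸ N) ≃* G ⧸ N := Shrink.mulEquiv
  refine ⟨Shrink.{0} (G ⧸ N), inferInstance, Finite.of_equiv _ e.symm.toEquiv,
    e.symm.toMonoidHom.comp (QuotientGroup.mk' N), ?_, ?_⟩
  · exact e.symm.surjective.comp (QuotientGroup.mk'_surjective N)
  · ext g
    simp

lemma normal_of_conj {G : Type*} [Group G] [Finite G] {a b z : G}
    (hc : Subgroup.closure ({a, b} : Set G) = ⊤) (ha : a * z * a⁻¹ ∈ Subgroup.zpowers z)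
    (hb : b * z * b⁻¹ ∈ Subgroup.zpowers z) : (Subgroup.zpowers z).Normal := by
  have key : ∀ g : G, g * z * g⁻¹ ∈ Subgroup.zpowers z →
      g ∈ Subgroup.normalizer (Subgroup.zpowers z : Set G) := by
    intro g hg
    rw [Subgroup.mem_normalizer_iff_map_conj_eq, MonoidHom.map_zpowers]
    apply Subgroup.eq_of_le_of_card_ge
    · rw [Subgroup.zpowers_le]; exact hg
    · rw [Nat.card_zpowers, Nat.card_zpowers]
      have : orderOf ((MulAut.conj g) z) = orderOf z := MulEquiv.orderOf_eq (MulAut.conj g) z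
      exact this.ge
  rw [← Subgroup.normalizer_eq_top_iff, eq_top_iff, ← hc, Subgroup.closure_le]
  rintro x (rfl | rfl)
  · exact key _ ha
  · exact key _ hb

lemma core_normal {G : Type*} [Group G] [Finite G] {a b : G} {m A D : ℕ} (hm : m.Prime)
    (hmo : Odd m) (hA : A < D)
    (h : IsRotPair a b (2 * m ^ A) (m ^ D)) (ht : IsTight a b) :
    (Subgroup.zpowers (b ^ m ^ (D - 1))).Normal := by
  have hcard := card_eq h ht
  have hob := h.2.2.1
  have hm3 : 3 ≤ m := by
    have := hm.two_le
    rcases hmo with ⟨k, hk⟩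
    omega
  have : Fact m.Prime := ⟨hm⟩
  have hqD : m ^ (D - 1) * m = m ^ D := by rw [← pow_succ]; congr 1; omega
  obtain ⟨z, hz⟩ : ∃ z, z = b ^ m ^ (D - 1) := ⟨_, rfl⟩
  have hzo : orderOf z = m := by
    rw [hz, orderOf_pow_of_dvd (pow_pos hm.pos _).ne' (by rw [hob]; exact pow_dvd_pow _ (by omega)),
      hob, ← hqD, Nat.mul_div_cancel_left _ (pow_pos hm.pos _)]
  rw [← hz]
  -- any element of order m in a cyclic group generated by an element of order m ^ D
  have key : ∀ (c g : G), orderOf c = m ^ D → g ∈ Subgroup.zpowers c → orderOf g = m →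
      Subgroup.zpowers g = Subgroup.zpowers (c ^ m ^ (D - 1)) := by
    intro c g hc hg hgo
    have hco : orderOf (c ^ m ^ (D - 1)) = m := by
      rw [orderOf_pow_of_dvd (pow_pos hm.pos _).ne' (by rw [hc]; exact pow_dvd_pow _ (by omega)),
        hc, ← hqD, Nat.mul_div_cancel_left _ (pow_pos hm.pos _)]
    apply Subgroup.eq_of_le_of_card_ge
    · rw [Subgroup.zpowers_le]
      obtain ⟨i, rfl⟩ := hg
      have h1 : (c ^ i) ^ m = 1 := by rw [← hgo]; exact pow_orderOf_eq_one _
      rw [← zpow_natCast, ← zpow_mul, ← orderOf_dvd_iff_zpow_eq_one, hc, ← hqD] at h1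
      push_cast at h1
      obtain ⟨k, rfl⟩ := Int.dvd_of_mul_dvd_mul_right (by exact_mod_cast hm.ne_zero) h1
      exact ⟨k, by simp only [← zpow_natCast, ← zpow_mul]; push_cast; rfl⟩
    · rw [Nat.card_zpowers, Nat.card_zpowers, hco, hgo]
  obtain ⟨c, hc⟩ : ∃ c, c = a * b * a⁻¹ := ⟨_, rfl⟩
  have hco : orderOf c = m ^ D := by
    rw [hc, ← hob]; exact MulEquiv.orderOf_eq (MulAut.conj a) b
  have hbig : Nat.card G < m ^ D * m ^ D := by
    rw [hcard]
    apply Nat.mul_lt_mul_of_pos_right _ (pow_pos hm.pos _)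
    calc 2 * m ^ A < m * m ^ A := Nat.mul_lt_mul_of_pos_right (by omega) (pow_pos hm.pos _)
      _ = m ^ (A + 1) := by ring
      _ ≤ m ^ D := Nat.pow_le_pow_right hm.pos (by omega)
  have hne : Subgroup.zpowers b ⊓ Subgroup.zpowers c ≠ ⊥ := by
    intro hbot
    let F : Subgroup.zpowers b × Subgroup.zpowers c → G := fun x => x.1 * x.2
    have hF : Function.Injective F := by
      rintro ⟨⟨x, hx⟩, ⟨y, hy⟩⟩ ⟨⟨x', hx'⟩, ⟨y', hy'⟩⟩ e
      change x * y = x' * y' at e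
      have e2 : x'⁻¹ * x = y' * y⁻¹ := by
        rw [inv_mul_eq_iff_eq_mul, ← mul_assoc, ← e]; group
      have h1 : x'⁻¹ * x ∈ Subgroup.zpowers b ⊓ Subgroup.zpowers c := 
        Subgroup.mem_inf.2 ⟨mul_mem (inv_mem hx') hx,
          (by rw [e2]; exact mul_mem hy' (inv_mem hy))⟩
      rw [hbot, Subgroup.mem_bot] at h1
      have h2 : y' * y⁻¹ = 1 := by rw [← e2, h1]
      have hx : x' = x := by rwa [inv_mul_eq_one] at h1
      have hy : y' = y := by rwa [mul_inv_eq_one] at h2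
      subst hx hy; rfl
    have := Nat.card_le_card_of_injective F hF
    rw [Nat.card_prod, Nat.card_zpowers, Nat.card_zpowers, hob, hco] at this
    omega
  have hdvd : m ∣ Nat.card (Subgroup.zpowers b ⊓ Subgroup.zpowers c : Subgroup G) := by
    have h1 : Nat.card (Subgroup.zpowers b ⊓ Subgroup.zpowers c : Subgroup G) ∣ m ^ D := by
      rw [← hob, ← Nat.card_zpowers]
      exact Subgroup.card_dvd_of_le inf_le_left
    obtain ⟨k, -, hk⟩ := (Nat.dvd_prime_pow hm).1 h1
    rw [hk]
    rcases Nat.eq_zero_or_pos k with rfl | hk0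
    · exfalso
      apply hne
      rw [pow_zero] at hk
      exact Subgroup.card_eq_one.1 hk
    · exact dvd_pow_self _ hk0.ne'
  obtain ⟨⟨g, hgb, hgc⟩, hg⟩ := exists_prime_orderOf_dvd_card' m hdvd
  have hgo : orderOf g = m := by rw [← hg]; exact (Subgroup.orderOf_mk _ _).symm
  have e1 := key b g hob hgb hgo
  have e2 := key c g hco hgc hgo
  rw [e1, ← hz] at e2
  apply normal_of_conj h.1
  · rw [e2]
    have : a * z * a⁻¹ = c ^ m ^ (D - 1) := by rw [hz, hc, conj_pow]
    rw [this]
    exact Subgroup.mem_zpowers _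
  · have : b * z * b⁻¹ = z := by rw [hz]; group
    rw [this]
    exact Subgroup.mem_zpowers _

/-- Structure of atomic chiral rotation pairs of type `(2·m^α, m^(α+β))`, `m` an odd prime. -/
theorem atomic_odd_prime_structure {G : Type*} [Group G] [Finite G] (a b : G)
    (m α β : ℕ) (hm : m.Prime) (hmodd : Odd m) (hα : 1 ≤ α) (hβ : 1 ≤ β)
    (h : IsAtomicPair a b (2 * m ^ α) (m ^ (α + β))) :
    α = 1 ∧ ∃ k : ℤ, 1 ≤ k ∧ k ≤ (m : ℤ) - 1 ∧
      b⁻¹ * a = a ^ (3 : ℤ) * b ^ (1 + k * (m : ℤ) ^ β) ∧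
      b * a⁻¹ = a ^ (-3 : ℤ) * b ^ (-1 + k * (m : ℤ) ^ β) := by
  obtain ⟨h, ht, hch, hat1, hat2⟩ := h
  obtain ⟨D, hD⟩ : ∃ D, D = α + β := ⟨_, rfl⟩
  rw [← hD] at h hat1 hat2
  have hM := core_normal hm hmodd (by omega) h ht
  obtain ⟨n, hn⟩ : ∃ n, n = m ^ (D - 1) := ⟨_, rfl⟩
  have hnm : n * m = m ^ D := by rw [hn, ← pow_succ]; congr 1; omega
  have hmn : m ∣ n := by rw [hn]; exact dvd_pow_self _ (by omega)
  have hn2 : 2 ≤ n := hm.two_le.trans (Nat.le_of_dvd (by rw [hn]; exact pow_pos hm.pos _) hmn)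
  obtain ⟨z, hz⟩ : ∃ z, z = b ^ n := ⟨_, rfl⟩
  rw [← hn, ← hz] at hM
  obtain ⟨-, hoa, hob, -, hq2, hab, -⟩ := id h
  have hzm : z ^ m = 1 := by rw [hz, ← pow_mul, hnm, ← hob, pow_orderOf_eq_one]
  have hp2 : ∀ e, 1 ≤ e → 2 ≤ 2 * m ^ e := fun e _ => by
    have := Nat.pow_pos (n := e) hm.pos
    omega
  have hncomm : ¬ Commute (a ^ 2) b := fun hc =>
    hch (regular_of_comm (even_two_mul _) hmodd.pow h ht hc)
  have hzb : z ∈ Subgroup.zpowers b := by rw [hz]; exact Subgroup.npow_mem_zpowers _ _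
  -- the commutator lies in M
  have hcm : a ^ 2 * b * (a ^ 2)⁻¹ * b⁻¹ ∈ Subgroup.zpowers z := by
    obtain ⟨H, iH, fH, f, hf, hk⟩ := exists_quot (Subgroup.zpowers z)
    have hkb : f.ker ≤ Subgroup.zpowers b := by rw [hk, Subgroup.zpowers_le]; exact hzb
    have hr : IsRotPair (f a) (f b) (2 * m ^ α) (m ^ (D - 1)) := by
      apply rot_map f hf h _ _ (hp2 _ hα) (hn ▸ hn2) (Or.inr hkb)
      · rw [← hoa]
        exact order_map_same f (fun k e => zero_b h (Subgroup.npow_mem_zpowers _ _) (hkb e))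
      · rw [← hn]
        exact order_map_quot f (by rw [hob, ← hnm]; exact dvd_mul_right _ _) (by rw [hk, hz])
    have htf := tight_map f hf ht
    have hreg : IsOrientablyRegular (f a) (f b) := by
      by_contra hcon
      exact hat2 H iH fH (f a) (f b) _ (Nat.pow_lt_pow_right hm.one_lt (by omega)) hr htf hcon
        ⟨f, rfl, rfl⟩
    have := comm_of_regular hm hmodd hα hr htf hreg
    rw [← hk, MonoidHom.mem_ker]
    simp only [map_mul, map_inv, map_pow]
    rw [this.eq]; group
  obtain ⟨y, hy⟩ : ∃ y, y = a ^ 2 := ⟨_, rfl⟩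
  rw [← hy] at hcm hncomm
  obtain ⟨l, hl⟩ := hcm
  simp only at hl
  have hzbc : Commute z b := by rw [hz]; exact Commute.pow_self b n
  have hyb : y * b * y⁻¹ = z ^ l * b := by rw [hl]; group
  have hzn : z ^ n = 1 := by
    obtain ⟨n', hn'⟩ := hmn
    rw [hn', pow_mul, hzm, one_pow]
  have hyz : y * z * y⁻¹ = z := by
    conv_lhs => rw [hz, ← conj_pow, hyb, (hzbc.zpow_left l).mul_pow, ← hz, ← zpow_natCast,
      ← zpow_mul, mul_comm, zpow_mul, zpow_natCast, hzn, one_zpow, one_mul]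
  have hyzc : Commute y z := by
    rw [mul_inv_eq_iff_eq_mul] at hyz
    exact hyz
  have hpow : ∀ i : ℕ, y ^ i * b = z ^ (l * i) * b * y ^ i := by
    intro i
    induction i with
    | zero => simp
    | succ i ih =>
      have h1 : y * b = z ^ l * b * y := by rw [← hyb]; group
      have h2 : y * z ^ (l * i) = z ^ (l * i) * y := (hyzc.zpow_right _).eq
      calc y ^ (i + 1) * b = y * (y ^ i * b) := by rw [pow_succ']; group
        _ = (y * z ^ (l * i)) * (b * y ^ i) := by rw [ih]; group
        _ = z ^ (l * i) * (y * b) * y ^ i := by rw [h2]; group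
        _ = (z ^ (l * i) * z ^ l) * b * (y * y ^ i) := by rw [h1]; group
        _ = _ := by rw [← zpow_add, ← pow_succ']; push_cast; rw [mul_add, mul_one]
  have hzdvd : ∀ i : ℤ, (m : ℤ) ∣ i → z ^ i = 1 := by
    rintro i ⟨k, rfl⟩
    rw [zpow_mul, zpow_natCast, hzm, one_zpow]
  have hα1 : α = 1 := by
    by_contra hne
    have hα2 : 2 ≤ α := by omega
    apply hncomm
    obtain ⟨w, hw⟩ : ∃ w, w = a ^ (2 * m ^ (α - 1)) := ⟨_, rfl⟩
    have hwy : w = y ^ (m ^ (α - 1)) := by rw [hw, hy, pow_mul]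
    have hwb : w * b = b * w := by
      rw [hwy, hpow, hzdvd, one_mul]
      push_cast
      exact Dvd.dvd.mul_left (dvd_pow_self _ (by omega)) _
    have hK : (Subgroup.zpowers w).Normal := by
      apply normal_of_conj h.1
      · have : a * w * a⁻¹ = w := by rw [hw]; group
        rw [this]; exact Subgroup.mem_zpowers _
      · have : b * w * b⁻¹ = w := by rw [← hwb]; group
        rw [this]; exact Subgroup.mem_zpowers _
    have hwa : w ∈ Subgroup.zpowers a := by rw [hw]; exact Subgroup.npow_mem_zpowers _ _
    obtain ⟨H, iH, fH, f, hf, hk⟩ := exists_quot (Subgroup.zpowers w)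
    have hka : f.ker ≤ Subgroup.zpowers a := by rw [hk, Subgroup.zpowers_le]; exact hwa
    have hr : IsRotPair (f a) (f b) (2 * m ^ (α - 1)) (m ^ D) := by
      apply rot_map f hf h _ _ (hp2 _ (by omega)) hq2 (Or.inl hka)
      · exact order_map_quot f (by
          rw [hoa]; exact Nat.mul_dvd_mul_left _ (pow_dvd_pow _ (by omega))) (by rw [hk, hw])
      · rw [← hob]
        exact order_map_same f (fun k e => zero_b h (hka e) (Subgroup.npow_mem_zpowers _ _))
    have htf := tight_map f hf ht
    have hreg : IsOrientablyRegular (f a) (f b) := by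
      by_contra hcon
      exact hat1 H iH fH (f a) (f b) _ (Nat.mul_lt_mul_of_pos_left
        (Nat.pow_lt_pow_right hm.one_lt (by omega)) (by omega)) hr htf hcon ⟨f, rfl, rfl⟩
    have hcomm := comm_of_regular hm hmodd (by omega) hr htf hreg
    have h1 : y * b * y⁻¹ * b⁻¹ ∈ f.ker := by
      rw [MonoidHom.mem_ker, hy]
      simp only [map_mul, map_inv, map_pow]
      rw [hcomm.eq]; group
    have h2 : y * b * y⁻¹ * b⁻¹ = 1 := by
      apply zero_b h (hka h1)
      rw [← hl]
      exact zpow_mem hzb _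
    rw [mul_inv_eq_one, mul_inv_eq_iff_eq_mul] at h2
    exact h2
  refine ⟨hα1, (-l) % m, ?_, ?_, ?_, ?_⟩
  all_goals have hm0 : (0 : ℤ) < m := by exact_mod_cast hm.pos
  · have h1 := Int.emod_nonneg (-l) hm0.ne'
    have h2 : (-l) % m ≠ 0 := by
      intro h0
      apply hncomm
      have h3 : z ^ l = 1 := hzdvd l ((dvd_neg).1 (Int.dvd_of_emod_eq_zero h0))
      rw [h3, one_mul, mul_inv_eq_iff_eq_mul] at hyb
      exact hyb
    omega
  · have := Int.emod_lt_of_pos (-l) hm0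
    omega
  all_goals
    have hnβ : n = m ^ β := by rw [hn]; congr 1; omega
    have hzk : b ^ ((-l) % m * (m : ℤ) ^ β) = z ^ (-l) := by
      have e : (m : ℤ) ^ β = (n : ℤ) := by rw [hnβ]; push_cast; rfl
      rw [e, mul_comm, zpow_mul, zpow_natCast, ← hz]
      have e2 : -l = (-l) % m + m * (-l / m) := (Int.emod_add_mul_ediv _ _).symm
      conv_rhs => rw [e2, zpow_add, hzdvd _ (dvd_mul_right _ _), mul_one]
    have haba : a * b * a = b⁻¹ := by
      rw [eq_comm]
      apply inv_eq_of_mul_eq_one_left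
      rw [← hab, pow_two]; group
  · have h1 : b * z ^ (-l) = y⁻¹ * b * y := by
      have e : b = z ^ (-l) * (y * b * y⁻¹) := by rw [hyb]; group
      have hc : Commute y (z ^ (-l)) := hyzc.zpow_right _
      have hc2 : Commute (z ^ (-l)) b := hzbc.zpow_left _
      have e3 : y⁻¹ * b * y = y⁻¹ * (z ^ (-l) * (y * b * y⁻¹)) * y := by rw [← e]
      rw [e3, ← mul_assoc (z ^ (-l)), ← mul_assoc (z ^ (-l)), ← hc.eq, ← hc2.eq]; group
    rw [zpow_add, zpow_one, hzk, h1, ← haba, hy, pow_two]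
    group
  · have h1 : b⁻¹ * z ^ (-l) = y * b⁻¹ * y⁻¹ := by
      have e : y * b⁻¹ * y⁻¹ = (y * b * y⁻¹)⁻¹ := by group
      rw [e, hyb]; group
    have e4 : b = a⁻¹ * b⁻¹ * a⁻¹ := by
      have := congrArg (fun g => g⁻¹) haba
      simp only [inv_inv] at this
      conv_lhs => rw [← this]
      group
    rw [zpow_add, zpow_neg_one, hzk, h1, hy]
    conv_lhs => rw [e4]
    group
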